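/- arXiv:1005.0875 — 2 statements merged into one kernel-verified Lean document; each statement's English description precedes it below -/
import Mathlib

section
/- Let a ∈ (0,1] and set Ω = { (x,y) ∈ ℝ² : 0 < y < a and |x| < a² − a y } (the open triangle with vertices (−a²,0), (a²,0) and (0,a)). Let u : ℝ² → ℝ be continuously differentiable on an open set containing the closure of Ω and suppose u(x,0) = 0 for all x with |x| ≤ a². Then ∫₀ᵃ ( u(a² − a t, t)² + u(a t − a², t)² ) dt ≤ ∫_Ω ‖∇u‖² dλ, where λ is two-dimensional Lebesgue measure and ‖∇u‖ is the Euclidean norm of the gradient of u. -/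
open MeasureTheory

lemma cs_aux (v : ℝ → ℝ) (t c : ℝ) (ht : 0 < t)
    (hv : ContinuousOn v (Set.Icc 0 t)) (hc : ∫ s in (0:ℝ)..t, v s = c) :
    c ^ 2 ≤ t * ∫ s in (0:ℝ)..t, v s ^ 2 := by
  have hv' : ContinuousOn v (Set.uIcc 0 t) := by rwa [Set.uIcc_of_le ht.le]
  have h1 : IntervalIntegrable v volume 0 t := hv'.intervalIntegrable
  have h2 : IntervalIntegrable (fun s => v s ^ 2) volume 0 t := (hv'.pow 2).intervalIntegrable
  have h3 : ∫ s in (0:ℝ)..t, (2 * (c / t) * v s - (c / t) ^ 2) ≤ ∫ s in (0:ℝ)..t, v s ^ 2 := by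
    apply intervalIntegral.integral_mono_on ht.le ((h1.const_mul _).sub (by simp)) h2
    intro s _
    nlinarith [sq_nonneg (v s - c / t)]
  rw [intervalIntegral.integral_sub (h1.const_mul _) (by simp),
    intervalIntegral.integral_const_mul, hc, intervalIntegral.integral_const] at h3
  have h4 := mul_le_mul_of_nonneg_left h3 ht.le
  refine le_trans (le_of_eq ?_) h4
  simp only [smul_eq_mul]
  field_simp
  ring

theorem stmt11 (a : ℝ) (ha : 0 < a) (ha1 : a ≤ 1)
    (Ω : Set (ℝ × ℝ))
    (hΩ : Ω = {p : ℝ × ℝ | 0 < p.2 ∧ p.2 < a ∧ |p.1| < a ^ 2 - a * p.2})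
    (u : ℝ × ℝ → ℝ)
    (U : Set (ℝ × ℝ)) (hU : IsOpen U) (hΩU : closure Ω ⊆ U)
    (hu : ContDiffOn ℝ 1 u U)
    (hu0 : ∀ x : ℝ, |x| ≤ a ^ 2 → u (x, 0) = 0) :
    (∫ t in Set.Ioo (0 : ℝ) a,
        ((u (a ^ 2 - a * t, t)) ^ 2 + (u (a * t - a ^ 2, t)) ^ 2)) ≤
      ∫ p in Ω, ((fderiv ℝ u p (1, 0)) ^ 2 + (fderiv ℝ u p (0, 1)) ^ 2) := by
  have hΩo : IsOpen Ω := by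
    rw [hΩ]
    have e : {p : ℝ × ℝ | 0 < p.2 ∧ p.2 < a ∧ |p.1| < a ^ 2 - a * p.2} =
      {p | 0 < p.2} ∩ ({p | p.2 < a} ∩ {p | |p.1| < a ^ 2 - a * p.2}) := rfl
    rw [e]
    exact (isOpen_lt (by fun_prop) (by fun_prop)).inter
      ((isOpen_lt (by fun_prop) (by fun_prop)).inter (isOpen_lt (by fun_prop) (by fun_prop)))
  have hΩm : MeasurableSet Ω := hΩo.measurableSet
  have hbd : Bornology.IsBounded Ω := by
    apply (Metric.isBounded_Icc ((-a^2, 0) : ℝ × ℝ) (a^2, a)).subset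
    rw [hΩ]
    rintro ⟨x, y⟩ ⟨h1, h2, h3⟩
    simp only at h1 h2 h3
    rw [abs_lt] at h3
    have := mul_pos ha h1
    refine ⟨⟨?_, ?_⟩, ⟨?_, ?_⟩⟩ <;> simp only <;> linarith
  have hK : IsCompact (closure Ω) := hbd.isCompact_closure
  have hfd : ContinuousOn (fderiv ℝ u) U := hu.continuousOn_fderiv_of_isOpen hU le_rfl
  have hfdv : ∀ w : ℝ × ℝ, ContinuousOn (fun p => fderiv ℝ u p w) U :=
    fun w => hfd.clm_apply continuousOn_const
  have hint : ∀ w : ℝ × ℝ, IntegrableOn (fun p => (fderiv ℝ u p w) ^ 2) Ω := fun w =>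
    ((((hfdv w).pow 2).mono hΩU).integrableOn_compact hK).mono_set subset_closure
  set g : ℝ × ℝ → ℝ := fun p => (fderiv ℝ u p (0, 1)) ^ 2 with hg
  set F : ℝ × ℝ → ℝ := Ω.indicator g with hF
  have hF0 : ∀ p, 0 ≤ F p := fun p => Set.indicator_nonneg (fun q _ => sq_nonneg _) p
  have hFi : Integrable F (volume.prod volume) := by
    rw [← Measure.volume_eq_prod]
    exact (hint (0, 1)).integrable_indicator hΩm
  set G : ℝ → ℝ := fun x => ∫ y, F (x, y) with hG
  have hG0 : ∀ x, 0 ≤ G x := fun x => integral_nonneg fun y => hF0 _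
  have hGi : Integrable G := hFi.integral_prod_left
  have hFG : ∫ p in Ω, g p = ∫ x, G x := by
    rw [← integral_indicator hΩm, Measure.volume_eq_prod, integral_prod _ hFi]
  -- pointwise bound
  have hpt : ∀ x t : ℝ, 0 < t → t < a → |x| = a ^ 2 - a * t → (u (x, t)) ^ 2 ≤ a * G x := by
    intro x t ht hta hx
    have hmem : ∀ s, (x, s) ∈ Ω ↔ s ∈ Set.Ioo 0 t := by
      intro s
      rw [hΩ]
      simp only [Set.mem_setOf_eq, Set.mem_Ioo, hx]
      constructor
      · rintro ⟨h1, -, h3⟩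
        exact ⟨h1, by nlinarith⟩
      · rintro ⟨h1, h2⟩
        exact ⟨h1, by linarith, by nlinarith⟩
    have hsub : ∀ s ∈ Set.Icc 0 t, (x, s) ∈ U := by
      intro s hs
      apply hΩU
      rw [← closure_Ioo ht.ne] at hs
      exact map_mem_closure (f := fun s : ℝ => (x, s)) (by fun_prop) hs
        (fun r hr => (hmem r).2 hr)
    have hcont : ContinuousOn (fun s => fderiv ℝ u (x, s) (0, 1)) (Set.Icc 0 t) :=
      (hfdv (0, 1)).comp (by fun_prop) hsub
    have hder : ∀ s ∈ Set.uIcc 0 t,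
        HasDerivAt (fun s => u (x, s)) (fderiv ℝ u (x, s) (0, 1)) s := by
      intro s hs
      rw [Set.uIcc_of_le ht.le] at hs
      have hd : HasFDerivAt u (fderiv ℝ u (x, s)) (x, s) :=
        ((hu.differentiableOn one_ne_zero).differentiableAt
          (hU.mem_nhds (hsub s hs))).hasFDerivAt
      exact hd.comp_hasDerivAt s ((hasDerivAt_const s x).prodMk (hasDerivAt_id s))
    have hftc := intervalIntegral.integral_eq_sub_of_hasDerivAt hder
      (by apply ContinuousOn.intervalIntegrable; rwa [Set.uIcc_of_le ht.le])
    rw [hu0 x (by rw [hx]; nlinarith [mul_pos ha ht]), sub_zero] at hftc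
    have h := cs_aux _ t _ ht hcont hftc
    have hGx : G x = ∫ s in (0:ℝ)..t, (fderiv ℝ u (x, s) (0, 1)) ^ 2 := by
      rw [intervalIntegral.integral_of_le ht.le, integral_Ioc_eq_integral_Ioo,
        ← integral_indicator measurableSet_Ioo]
      simp only [hG]
      congr 1
      ext s
      by_cases hs : s ∈ Set.Ioo 0 t
      · rw [hF, Set.indicator_of_mem ((hmem s).2 hs), Set.indicator_of_mem hs]
      · rw [hF, Set.indicator_of_notMem (fun h => hs ((hmem s).1 h)),
          Set.indicator_of_notMem hs]
    rw [← hGx] at h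
    exact h.trans (mul_le_mul_of_nonneg_right hta.le (hG0 x))
  have hi1 : Integrable (fun t => G (a ^ 2 - a * t)) :=
    (hGi.comp_sub_left (a ^ 2)).comp_mul_left' ha.ne'
  have hi2 : Integrable (fun t => G (a * t - a ^ 2)) :=
    (hGi.comp_sub_right (a ^ 2)).comp_mul_left' ha.ne'
  calc _ ≤ ∫ t in Set.Ioo (0:ℝ) a, (a * G (a ^ 2 - a * t) + a * G (a * t - a ^ 2)) := by
        apply integral_mono_of_nonneg
        · exact Filter.Eventually.of_forall fun t => by positivity
        · exact ((hi1.const_mul a).add (hi2.const_mul a)).integrableOn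
        · filter_upwards [ae_restrict_mem measurableSet_Ioo] with t ht
          have h0 : 0 ≤ a ^ 2 - a * t := by nlinarith [ht.1, ht.2]
          apply add_le_add
          · exact hpt _ t ht.1 ht.2 (abs_of_nonneg h0)
          · refine hpt _ t ht.1 ht.2 ?_
            rw [abs_of_nonpos (by linarith)]; ring
    _ = ∫ x in (-a^2)..(a^2), G x := by
        rw [← integral_Ioc_eq_integral_Ioo, ← intervalIntegral.integral_of_le ha.le,
          intervalIntegral.integral_add (hi1.const_mul a).intervalIntegrable
            (hi2.const_mul a).intervalIntegrable,
          intervalIntegral.integral_const_mul, intervalIntegral.integral_const_mul,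
          intervalIntegral.integral_comp_sub_mul G ha.ne',
          intervalIntegral.integral_comp_mul_sub G ha.ne',
          ← intervalIntegral.integral_add_adjacent_intervals (a := -a^2) (b := 0) (c := a^2)
            hGi.intervalIntegrable hGi.intervalIntegrable, smul_eq_mul, smul_eq_mul,
          mul_inv_cancel_left₀ ha.ne', mul_inv_cancel_left₀ ha.ne', add_comm]
        have e1 : a ^ 2 - a * a = 0 := by ring
        have e2 : a * a - a ^ 2 = 0 := by ring
        have e3 : a * 0 - a ^ 2 = -a ^ 2 := by ring
        have e4 : a ^ 2 - a * 0 = a ^ 2 := by ring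
        rw [e1, e2, e3, e4]
    _ ≤ ∫ x, G x := by
        rw [intervalIntegral.integral_of_le (by nlinarith)]
        exact setIntegral_le_integral hGi (Filter.Eventually.of_forall hG0)
    _ = ∫ p in Ω, g p := hFG.symm
    _ ≤ _ := by
        apply setIntegral_mono (hint (0, 1)) ((hint (1, 0)).add (hint (0, 1)))
        intro p
        simp only [hg, Pi.add_apply]
        nlinarith [sq_nonneg (fderiv ℝ u p (1, 0))]
end

section
/- Let Ω = { (x,y) ∈ ℝ² : 0 < x < 1 and −x⁴ < y < x⁴ }. Then the function (x,y) ↦ 1/x² is Lebesgue-integrable on Ω with ∫_Ω x^{−2} dλ(x,y) = 2/3, and the function (x,y) ↦ 1/x⁴ is Lebesgue-integrable on Ω with ∫_Ω x^{−4} dλ(x,y) = 2. In particular the function u(x,y) = 1/x and its gradient ∇u(x,y) = (−1/x², 0) are both square-integrable on Ω. -/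
open MeasureTheory

lemma cusp_aux (k m : ℕ) (hkm : m + k = 4) :
    IntegrableOn (fun p : ℝ × ℝ => (p.1 ^ k)⁻¹)
      {p : ℝ × ℝ | 0 < p.1 ∧ p.1 < 1 ∧ -p.1 ^ 4 < p.2 ∧ p.2 < p.1 ^ 4} volume ∧
    (∫ p in {p : ℝ × ℝ | 0 < p.1 ∧ p.1 < 1 ∧ -p.1 ^ 4 < p.2 ∧ p.2 < p.1 ^ 4}, (p.1 ^ k)⁻¹)
      = 2 / ((m : ℝ) + 1) := by
  set S : Set (ℝ × ℝ) := {p : ℝ × ℝ | 0 < p.1 ∧ p.1 < 1 ∧ -p.1 ^ 4 < p.2 ∧ p.2 < p.1 ^ 4} with hS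
  have hSm : MeasurableSet S := by
    have h1 : MeasurableSet {p : ℝ × ℝ | 0 < p.1} := measurableSet_lt (by fun_prop) (by fun_prop)
    have h2 : MeasurableSet {p : ℝ × ℝ | p.1 < 1} := measurableSet_lt (by fun_prop) (by fun_prop)
    have h3 : MeasurableSet {p : ℝ × ℝ | -p.1 ^ 4 < p.2} :=
      measurableSet_lt (by fun_prop) (by fun_prop)
    have h4 : MeasurableSet {p : ℝ × ℝ | p.2 < p.1 ^ 4} :=
      measurableSet_lt (by fun_prop) (by fun_prop)
    exact h1.inter (h2.inter (h3.inter h4))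
  set F : ℝ × ℝ → ℝ := S.indicator (fun p : ℝ × ℝ => (p.1 ^ k)⁻¹) with hF
  have hFm : Measurable F := Measurable.indicator (by fun_prop) hSm
  have hF0 : ∀ p, 0 ≤ F p := by
    intro p
    apply Set.indicator_nonneg
    rintro q ⟨h, -⟩
    positivity
  have hsec : ∀ x : ℝ, (fun y => F (x, y)) =
      if x ∈ Set.Ioo (0 : ℝ) 1 then
        (Set.Ioo (-x ^ 4) (x ^ 4)).indicator (fun _ => (x ^ k)⁻¹) else fun _ => 0 := by
    intro x
    funext y
    by_cases hx : x ∈ Set.Ioo (0 : ℝ) 1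
    · by_cases hy : y ∈ Set.Ioo (-x ^ 4) (x ^ 4)
      · have : (x, y) ∈ S := ⟨hx.1, hx.2, hy.1, hy.2⟩
        simp only [hF, if_pos hx, Set.indicator_of_mem this, Set.indicator_of_mem hy]
      · have : (x, y) ∉ S := fun h => hy ⟨h.2.2.1, h.2.2.2⟩
        simp only [hF, if_pos hx, Set.indicator_of_notMem this, Set.indicator_of_notMem hy]
    · have : (x, y) ∉ S := fun h => hx ⟨h.1, h.2.1⟩
      simp only [hF, if_neg hx, Set.indicator_of_notMem this]
  have hsecI : ∀ x : ℝ, Integrable (fun y => F (x, y)) := by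
    intro x
    rw [hsec]
    split_ifs
    · rw [integrable_indicator_iff measurableSet_Ioo]
      exact integrableOn_const (by simp)
    · exact integrable_zero _ _ _
  have hint : (fun x : ℝ => ∫ y, F (x, y)) =
      (Set.Ioo (0 : ℝ) 1).indicator (fun x => 2 * x ^ m) := by
    funext x
    rw [hsec]
    by_cases hx : x ∈ Set.Ioo (0 : ℝ) 1
    · rw [if_pos hx, Set.indicator_of_mem hx, integral_indicator measurableSet_Ioo,
        setIntegral_const, measureReal_def, Real.volume_Ioo, smul_eq_mul]
      have h0 : 0 < x := hx.1
      rw [ENNReal.toReal_ofReal (by have : 0 < x ^ 4 := by positivity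
                                    linarith), ← hkm, pow_add]
      field_simp
      ring
    · rw [if_neg hx, Set.indicator_of_notMem hx, integral_zero]
  have hI : Integrable F (volume.prod volume) := by
    rw [integrable_prod_iff hFm.aestronglyMeasurable]
    refine ⟨Filter.Eventually.of_forall hsecI, ?_⟩
    simp only [Real.norm_of_nonneg (hF0 _)]
    rw [hint, integrable_indicator_iff measurableSet_Ioo]
    exact (Continuous.integrableOn_Icc (by fun_prop)).mono_set Set.Ioo_subset_Icc_self
  refine ⟨(integrable_indicator_iff hSm).1 hI, ?_⟩
  rw [← integral_indicator hSm]
  change ∫ p, F p ∂(volume.prod volume) = _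
  rw [integral_prod _ hI, hint, integral_indicator measurableSet_Ioo,
    ← integral_Ioc_eq_integral_Ioo, ← intervalIntegral.integral_of_le zero_le_one]
  simp [integral_pow]
  try field_simp

/-- (Example 9.4 of the paper.) For the cusp domain
`Ω = {(x,y) : 0 < x < 1, −x⁴ < y < x⁴}`, the function `x⁻²` is integrable on `Ω` with
integral `2/3`, and `x⁻⁴` is integrable on `Ω` with integral `2`. In particular
`u(x,y) = 1/x` and its gradient `∇u = (−x⁻², 0)` are square-integrable on `Ω`. -/
theorem stmt13 (Ω : Set (ℝ × ℝ))
    (hΩ : Ω = {p : ℝ × ℝ | 0 < p.1 ∧ p.1 < 1 ∧ -p.1 ^ 4 < p.2 ∧ p.2 < p.1 ^ 4}) :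
    IntegrableOn (fun p : ℝ × ℝ => (p.1 ^ 2)⁻¹) Ω volume ∧
    (∫ p in Ω, (p.1 ^ 2)⁻¹) = 2 / 3 ∧
    IntegrableOn (fun p : ℝ × ℝ => (p.1 ^ 4)⁻¹) Ω volume ∧
    (∫ p in Ω, (p.1 ^ 4)⁻¹) = 2 ∧
    IntegrableOn (fun p : ℝ × ℝ => ((p.1)⁻¹) ^ 2) Ω volume ∧
    IntegrableOn (fun p : ℝ × ℝ => (-(p.1 ^ 2)⁻¹) ^ 2 + (0 : ℝ) ^ 2) Ω volume := by
  subst hΩ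
  obtain ⟨h1, h2⟩ := cusp_aux 2 2 rfl
  obtain ⟨h3, h4⟩ := cusp_aux 4 0 rfl
  refine ⟨h1, ?_, h3, ?_, ?_, ?_⟩
  · rw [h2]; norm_num
  · rw [h4]; norm_num
  · simpa only [inv_pow] using h1
  · have : (fun p : ℝ × ℝ => (-(p.1 ^ 2)⁻¹) ^ 2 + (0 : ℝ) ^ 2) = fun p => (p.1 ^ 4)⁻¹ := by
      funext p
      rw [neg_sq, inv_pow, ← pow_mul]
      norm_num
    rw [this]
    exact h3
end
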